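/- arXiv:1404.5119 — 4 statements merged into one kernel-verified Lean document; each statement's English description precedes it below -/
import Mathlib

section
/- Let q > 0 be a real number with q ≠ 1, let (a,b,c) be an admissible triple of nonnegative integers with (a+2,b,c) also admissible, and set x_a = q^{a/2}, x_b = q^{b/2}, x_c = q^{c/2}. Then the quantum A-polynomial operator in the a-direction annihilates the theta-graph invariant; explicitly, x_a (q x_a x_b − x_c)(q x_a x_c − x_b)(1 − q² x_a x_b x_c) · J_{a,b,c}(Θ;q) + q^{1/2} x_b x_c (1 − q² x_a²)(1 − q x_a²)(x_a − x_b x_c) · J_{a+2,b,c}(Θ;q) = 0. -/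
open Real Finset

/-- The quantum number `[n] = (q^{n/2} - q^{-n/2})/(q^{1/2} - q^{-1/2})`. -/
noncomputable def qNum (q : ℝ) (n : ℤ) : ℝ :=
  (q ^ ((n : ℝ) / 2) - q ^ (-((n : ℝ) / 2))) / (q ^ ((1 : ℝ) / 2) - q ^ (-((1 : ℝ) / 2)))

/-- The quantum factorial `[n]! = [n][n-1]⋯[1]`, with `[0]! = 1`. -/
noncomputable def qFact (q : ℝ) (n : ℕ) : ℝ := ∏ k ∈ Finset.range n, qNum q (k + 1)

/-- A triple `(a,b,c)` of nonnegative integers is admissible if `a+b+c` is even,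
`|a - b| ≤ c` and `c ≤ a + b`. -/
def Admissible (a b c : ℕ) : Prop :=
  Even (a + b + c) ∧ a ≤ b + c ∧ b ≤ a + c ∧ c ≤ a + b

/-- The quantum invariant of the theta graph colored by an admissible triple `(a,b,c)`:
`J_{a,b,c}(Θ;q) = (-1)^{(a+b+c)/2} [(a+b+c)/2+1]! [(-a+b+c)/2]! [(a-b+c)/2]! [(a+b-c)/2]!
  / ([a]![b]![c]!)`. -/
noncomputable def thetaInv (q : ℝ) (a b c : ℕ) : ℝ :=
  (-1 : ℝ) ^ ((a + b + c) / 2) *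
    (qFact q ((a + b + c) / 2 + 1) * qFact q ((b + c - a) / 2) *
      qFact q ((a + c - b) / 2) * qFact q ((a + b - c) / 2)) /
    (qFact q a * qFact q b * qFact q c)

theorem qFact_succ (q : ℝ) (n : ℕ) : qFact q (n + 1) = qFact q n * qNum q (n + 1) :=
  Finset.prod_range_succ _ _

theorem rpow_natCast_div_two {q : ℝ} (hq : 0 < q) (n : ℕ) :
    q ^ ((n : ℝ) / 2) = (q ^ ((1 : ℝ) / 2)) ^ n := by
  rw [← Real.rpow_mul_natCast hq.le]
  congr 1
  ring

theorem qNum_natCast {q : ℝ} (hq : 0 < q) (n : ℕ) :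
    qNum q n = ((q ^ ((1 : ℝ) / 2)) ^ n - ((q ^ ((1 : ℝ) / 2)) ^ n)⁻¹) /
      (q ^ ((1 : ℝ) / 2) - (q ^ ((1 : ℝ) / 2))⁻¹) := by
  simp only [qNum, Int.cast_natCast, Real.rpow_neg hq.le, rpow_natCast_div_two hq]

theorem pow_sub_inv_ne_zero {t : ℝ} (ht : 0 < t) (ht1 : t ≠ 1) {n : ℕ} (hn : n ≠ 0) :
    t ^ n - (t ^ n)⁻¹ ≠ 0 := by
  intro h
  have hp : 0 < t ^ n := pow_pos ht n
  have h1 : t ^ n * t ^ n = 1 := by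
    nth_rewrite 2 [sub_eq_zero.mp h]
    exact mul_inv_cancel₀ hp.ne'
  rw [← pow_add] at h1
  exact ht1 ((pow_eq_one_iff_of_nonneg ht.le (by omega)).mp h1)

theorem rpow_half_ne_one {q : ℝ} (hq1 : q ≠ 1) : q ^ ((1 : ℝ) / 2) ≠ 1 := by
  rw [← Real.sqrt_eq_rpow]
  exact fun h => hq1 (Real.sqrt_eq_one.mp h)

theorem qNum_succ_ne_zero {q : ℝ} (hq : 0 < q) (hq1 : q ≠ 1) (n : ℕ) :
    qNum q (n + 1) ≠ 0 := by
  have ht : 0 < q ^ ((1 : ℝ) / 2) := Real.rpow_pos_of_pos hq _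
  have ht1 := rpow_half_ne_one hq1
  have h := qNum_natCast hq (n + 1)
  push_cast at h
  rw [h]
  refine div_ne_zero (pow_sub_inv_ne_zero ht ht1 n.succ_ne_zero) ?_
  simpa using pow_sub_inv_ne_zero ht ht1 one_ne_zero

theorem qFact_ne_zero {q : ℝ} (hq : 0 < q) (hq1 : q ≠ 1) (n : ℕ) : qFact q n ≠ 0 :=
  Finset.prod_ne_zero_iff.mpr fun k _ => qNum_succ_ne_zero hq hq1 k

/-- The theta invariant in the coordinates `a = j + k`, `b = i + k`, `c = i + j`. -/
theorem thetaInv_add (q : ℝ) (i j k : ℕ) :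
    thetaInv q (j + k) (i + k) (i + j) =
      (-1 : ℝ) ^ (i + j + k) *
        (qFact q (i + j + k + 1) * qFact q i * qFact q j * qFact q k) /
        (qFact q (j + k) * qFact q (i + k) * qFact q (i + j)) := by
  have h1 : (j + k + (i + k) + (i + j)) / 2 = i + j + k := by omega
  have h2 : (i + k + (i + j) - (j + k)) / 2 = i := by omega
  have h3 : (j + k + (i + j) - (i + k)) / 2 = j := by omega
  have h4 : (j + k + (i + k) - (i + j)) / 2 = k := by omega
  rw [thetaInv, h1, h2, h3, h4]

/-- The ratio of two theta invariants whose first colors differ by `2`, cleared of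
denominators. -/
theorem thetaInv_recurrence {q : ℝ} (hq : 0 < q) (hq1 : q ≠ 1) (i j k : ℕ) :
    thetaInv q (j + k + 2) (i + 1 + k) (i + 1 + j) *
        (qNum q (i + 1 : ℕ) * qNum q (j + k + 1 : ℕ) * qNum q (j + k + 2 : ℕ)) =
      -(thetaInv q (j + k) (i + 1 + k) (i + 1 + j) *
        (qNum q (i + j + k + 3 : ℕ) * qNum q (j + 1 : ℕ) * qNum q (k + 1 : ℕ))) := by
  have e := thetaInv_add q i (j + 1) (k + 1)
  rw [show j + 1 + (k + 1) = j + k + 2 by ring, show i + (k + 1) = i + 1 + k by ring,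
    show i + (j + 1) = i + 1 + j by ring,
    show i + 1 + j + (k + 1) = i + j + k + 2 by ring] at e
  rw [e, thetaInv_add, show i + 1 + j + k = i + j + k + 1 by ring]
  simp only [qFact_succ q (i + j + k + 2), qFact_succ q i, qFact_succ q j, qFact_succ q k,
    qFact_succ q (j + k + 1), qFact_succ q (j + k)]
  have n1 := qNum_succ_ne_zero hq hq1 (j + k)
  have n2 := qNum_succ_ne_zero hq hq1 (j + k + 1)
  have f1 := qFact_ne_zero hq hq1 (j + k)
  have f2 := qFact_ne_zero hq hq1 (i + 1 + k)
  have f3 := qFact_ne_zero hq hq1 (i + 1 + j)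
  have c (n : ℕ) : qNum q (n + 1 : ℕ) = qNum q (n + 1) := by push_cast; rfl
  rw [c i, c j, c k, c (j + k), c (j + k + 1), c (i + j + k + 2)]
  field_simp
  ring

/-- The quantum A-polynomial operator in the `a`-direction annihilates the theta-graph
invariant: with `x_a = q^{a/2}`, `x_b = q^{b/2}`, `x_c = q^{c/2}`,
`x_a (q x_a x_b - x_c)(q x_a x_c - x_b)(1 - q² x_a x_b x_c) J_{a,b,c}
 + q^{1/2} x_b x_c (1 - q² x_a²)(1 - q x_a²)(x_a - x_b x_c) J_{a+2,b,c} = 0`. -/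
theorem theta_quantum_A_annihilates (q : ℝ) (hq : 0 < q) (hq1 : q ≠ 1)
    (a b c : ℕ) (h : Admissible a b c) (h2 : Admissible (a + 2) b c)
    (xa xb xc : ℝ) (hxa : xa = q ^ ((a : ℝ) / 2)) (hxb : xb = q ^ ((b : ℝ) / 2))
    (hxc : xc = q ^ ((c : ℝ) / 2)) :
    xa * (q * xa * xb - xc) * (q * xa * xc - xb) * (1 - q ^ 2 * xa * xb * xc) *
        thetaInv q a b c +
      q ^ ((1 : ℝ) / 2) * xb * xc * (1 - q ^ 2 * xa ^ 2) * (1 - q * xa ^ 2) *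
        (xa - xb * xc) * thetaInv q (a + 2) b c = 0 := by
  obtain ⟨i, j, k, rfl, rfl, rfl⟩ :
      ∃ i j k : ℕ, a = j + k ∧ b = i + 1 + k ∧ c = i + 1 + j := by
    obtain ⟨⟨s, hs⟩, h3, h4, h5⟩ := h
    obtain ⟨-, h6, -, -⟩ := h2
    exact ⟨s - a - 1, s - b, s - c, by omega, by omega, by omega⟩
  have hr := thetaInv_recurrence hq hq1 i j k
  have n1 : qNum q (i + 1 : ℕ) ≠ 0 := by exact_mod_cast qNum_succ_ne_zero hq hq1 i
  have n2 : qNum q (j + k + 1 : ℕ) ≠ 0 := by exact_mod_cast qNum_succ_ne_zero hq hq1 (j + k)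
  have n3 : qNum q (j + k + 2 : ℕ) ≠ 0 := by
    exact_mod_cast qNum_succ_ne_zero hq hq1 (j + k + 1)
  rw [← eq_div_iff (mul_ne_zero (mul_ne_zero n1 n2) n3)] at hr
  rw [hr]
  rw [rpow_natCast_div_two hq] at hxa hxb hxc
  simp only [qNum_natCast hq] at n1 n2 n3 ⊢
  have ht : 0 < q ^ ((1 : ℝ) / 2) := Real.rpow_pos_of_pos hq _
  have hd := pow_sub_inv_ne_zero ht (rpow_half_ne_one hq1) one_ne_zero
  have hqt : q = (q ^ ((1 : ℝ) / 2)) ^ 2 := by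
    rw [← Real.sqrt_eq_rpow, Real.sq_sqrt hq.le]
  rw [pow_one] at hd
  generalize thetaInv q (j + k) (i + 1 + k) (i + 1 + j) = θ
  generalize q ^ ((1 : ℝ) / 2) = t at *
  subst hqt
  have m (n : ℕ) : t ^ n - (t ^ n)⁻¹ = ((t ^ n) ^ 2 - 1) / t ^ n := by
    field_simp
  simp only [m] at n1 n2 n3 ⊢
  have p1 : (t ^ (i + 1)) ^ 2 - 1 ≠ 0 := fun h => n1 (by simp [h])
  have p2 : (t ^ (j + k + 1)) ^ 2 - 1 ≠ 0 := fun h => n2 (by simp [h])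
  have p3 : (t ^ (j + k + 2)) ^ 2 - 1 ≠ 0 := fun h => n3 (by simp [h])
  subst hxa hxb hxc
  clear n1 n2 n3 hr
  have hi := pow_pos ht i
  have hj := pow_pos ht j
  have hk := pow_pos ht k
  simp only [pow_add, pow_one] at p1 p2 p3 ⊢
  generalize t ^ i = I at *
  generalize t ^ j = J at *
  generalize t ^ k = K at *
  generalize hA : (I * t) ^ 2 - 1 = A at *
  generalize hB : (J * K * t) ^ 2 - 1 = B at *
  generalize hC : (J * K * t ^ 2) ^ 2 - 1 = C at *
  generalize t - t⁻¹ = D at *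
  field_simp
  rw [← hA, ← hB, ← hC]
  ring
end

section
/- Define the rational functions y_a(x_a,x_b,x_c) = − x_a(x_a x_b − x_c)(x_a x_c − x_b)(1 − x_a x_b x_c) / ( x_b x_c (1 − x_a²)² (x_a − x_b x_c) ), y_b(x_a,x_b,x_c) = − x_b(x_a x_b − x_c)(x_b x_c − x_a)(1 − x_a x_b x_c) / ( x_a x_c (1 − x_b²)² (x_b − x_a x_c) ), and y_c(x_a,x_b,x_c) = − x_c(x_a x_c − x_b)(x_b x_c − x_a)(1 − x_a x_b x_c) / ( x_a x_b (1 − x_c²)² (x_c − x_a x_b) ) (these are the unique solutions of A_a = A_b = A_c = 0). Then at every point of ℝ³ where all the factors appearing in the numerators and denominators of y_a, y_b, y_c are nonzero, the Lagrangian (closedness) conditions hold: x_b (∂y_a/∂x_b) · y_b = x_a (∂y_b/∂x_a) · y_a, x_c (∂y_b/∂x_c) · y_c = x_b (∂y_c/∂x_b) · y_b, and x_a (∂y_c/∂x_a) · y_a = x_c (∂y_a/∂x_c) · y_c. Equivalently, the symplectic form ∑_i d log x_i ∧ d log y_i vanishes identically on the variety cut out by A_a = A_b = A_c = 0. -/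
open Real

/-- The solution `y_a` of `A_a(y_a; x_a,x_b,x_c) = 0`:
`y_a = -x_a(x_a x_b - x_c)(x_a x_c - x_b)(1 - x_a x_b x_c) /
  (x_b x_c (1 - x_a²)² (x_a - x_b x_c))`. -/
noncomputable def yaFun (xa xb xc : ℝ) : ℝ :=
  -(xa * (xa * xb - xc) * (xa * xc - xb) * (1 - xa * xb * xc)) /
    (xb * xc * (1 - xa ^ 2) ^ 2 * (xa - xb * xc))

/-- The solution `y_b` of `A_b(y_b; x_a,x_b,x_c) = 0`. -/
noncomputable def ybFun (xa xb xc : ℝ) : ℝ :=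
  -(xb * (xa * xb - xc) * (xb * xc - xa) * (1 - xa * xb * xc)) /
    (xa * xc * (1 - xb ^ 2) ^ 2 * (xb - xa * xc))

/-- The solution `y_c` of `A_c(y_c; x_a,x_b,x_c) = 0`. -/
noncomputable def ycFun (xa xb xc : ℝ) : ℝ :=
  -(xc * (xa * xc - xb) * (xb * xc - xa) * (1 - xa * xb * xc)) /
    (xa * xb * (1 - xc ^ 2) ^ 2 * (xc - xa * xb))

theorem yaFun_swap (a b c : ℝ) : yaFun a c b = yaFun a b c := by
  unfold yaFun
  congr 1 <;> ring

theorem ybFun_eq_yaFun (a b c : ℝ) : ybFun a b c = yaFun b a c := by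
  unfold ybFun yaFun
  congr 1; ring

theorem ycFun_eq_yaFun (a b c : ℝ) : ycFun a b c = yaFun c a b := by
  unfold ycFun yaFun
  congr 1; ring

/-- The logarithmic derivative of `yaFun` in its second argument. -/
theorem mul_deriv_yaFun {a b c : ℝ} (hb : b ≠ 0) (hc : c ≠ 0)
    (h1 : a * b - c ≠ 0) (h2 : a * c - b ≠ 0) (h4 : 1 - a * b * c ≠ 0)
    (h5 : 1 - a ^ 2 ≠ 0) (h8 : a - b * c ≠ 0) :
    b * deriv (fun t => yaFun a t c) b =
      yaFun a b c * (a * b / (a * b - c) - b / (a * c - b) - a * b * c / (1 - a * b * c) - 1 +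
        b * c / (a - b * c)) := by
  have hid := hasDerivAt_id b
  have hab := (hid.const_mul a).sub_const c
  have hac := hid.const_sub (a * c)
  have habc := ((hid.const_mul a).mul_const c).const_sub 1
  have hnum := ((hab.const_mul a).mul hac).mul habc
  have hden := ((hid.mul_const c).mul_const ((1 - a ^ 2) ^ 2)).mul
    ((hid.mul_const c).const_sub a)
  have hne : b * c * (1 - a ^ 2) ^ 2 * (a - b * c) ≠ 0 := by positivity
  have h := (hnum.neg.div hden hne).deriv
  have hfun : deriv (fun t => yaFun a t c) b = _ := h
  rw [hfun]
  simp only [yaFun, Pi.mul_apply, Pi.neg_apply, id]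
  generalize hp : a * b - c = p at *
  generalize hq : a * c - b = q at *
  generalize hr : 1 - a * b * c = r at *
  generalize hs : a - b * c = s at *
  generalize hu : 1 - a ^ 2 = u at *
  field_simp
  ring

/-- The closedness condition for one pair of variables, in terms of `yaFun` alone. -/
theorem yaFun_closed {a b c : ℝ} (ha : a ≠ 0) (hb : b ≠ 0) (hc : c ≠ 0)
    (h1 : a * b - c ≠ 0) (h4 : 1 - a * b * c ≠ 0)
    (h5 : 1 - a ^ 2 ≠ 0) (h6 : 1 - b ^ 2 ≠ 0)
    (h8 : a - b * c ≠ 0) (h9 : b - a * c ≠ 0) :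
    b * deriv (fun t => yaFun a t c) b * yaFun b a c =
      a * deriv (fun t => yaFun b t c) a * yaFun a b c := by
  have h2 : a * c - b ≠ 0 := by rw [← neg_sub]; exact neg_ne_zero.mpr h9
  have h3 : b * c - a ≠ 0 := by rw [← neg_sub]; exact neg_ne_zero.mpr h8
  have hba : b * a - c ≠ 0 := by rwa [mul_comm b a]
  have hbac : 1 - b * a * c ≠ 0 := by rwa [mul_comm b a]
  rw [mul_deriv_yaFun hb hc h1 h2 h4 h5 h8, mul_deriv_yaFun ha hc hba h3 hbac h6 h9,
    mul_comm b a]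
  have e1 : b / (a * c - b) + a * c / (b - a * c) = -1 := by
    rw [← neg_sub b, div_neg]
    field_simp
    ring
  have e2 : a / (b * c - a) + b * c / (a - b * c) = -1 := by
    rw [← neg_sub a, div_neg]
    field_simp
    ring
  linear_combination yaFun a b c * yaFun b a c * (e2 - e1)

/-- At every point where all the factors appearing in the numerators and denominators of
`y_a, y_b, y_c` are nonzero, the Lagrangian (closedness) conditions hold:
`x_b (∂y_a/∂x_b) y_b = x_a (∂y_b/∂x_a) y_a`, `x_c (∂y_b/∂x_c) y_c = x_b (∂y_c/∂x_b) y_b`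
and `x_a (∂y_c/∂x_a) y_a = x_c (∂y_a/∂x_c) y_c`; equivalently the symplectic form
`∑ᵢ d log xᵢ ∧ d log yᵢ` vanishes on the variety cut out by `A_a = A_b = A_c = 0`. -/
theorem theta_lagrangian_condition (xa xb xc : ℝ)
    (ha : xa ≠ 0) (hb : xb ≠ 0) (hc : xc ≠ 0)
    (h1 : xa * xb - xc ≠ 0) (h2 : xa * xc - xb ≠ 0) (h3 : xb * xc - xa ≠ 0)
    (h4 : 1 - xa * xb * xc ≠ 0)
    (h5 : 1 - xa ^ 2 ≠ 0) (h6 : 1 - xb ^ 2 ≠ 0) (h7 : 1 - xc ^ 2 ≠ 0)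
    (h8 : xa - xb * xc ≠ 0) (h9 : xb - xa * xc ≠ 0) (h10 : xc - xa * xb ≠ 0) :
    xb * deriv (fun t => yaFun xa t xc) xb * ybFun xa xb xc =
      xa * deriv (fun t => ybFun t xb xc) xa * yaFun xa xb xc ∧
    xc * deriv (fun t => ybFun xa xb t) xc * ycFun xa xb xc =
      xb * deriv (fun t => ycFun xa t xc) xb * ybFun xa xb xc ∧
    xa * deriv (fun t => ycFun t xb xc) xa * yaFun xa xb xc =
      xc * deriv (fun t => yaFun xa xb t) xc * ycFun xa xb xc := by
  simp only [ybFun_eq_yaFun, ycFun_eq_yaFun]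
  refine ⟨yaFun_closed ha hb hc h1 h4 h5 h6 h8 h9, ?_, ?_⟩
  · have h := yaFun_closed (a := xb) (b := xc) (c := xa) hb hc ha h3
      (by convert h4 using 1; ring) h6 h7 (by rwa [mul_comm xc]) (by rwa [mul_comm xb])
    simpa only [yaFun_swap _ _ xa] using h
  · have h := yaFun_closed (a := xc) (b := xa) (c := xb) hc ha hb (by rwa [mul_comm xc])
      (by convert h4 using 1; ring) h7 h5 h10 (by rwa [mul_comm xc])
    simpa only [yaFun_swap] using h
end

section
/- Let x_a, x_b, x_c be positive reals such that all seven numbers x_a x_b x_c, x_a^{−1} x_b x_c, x_a x_b^{−1} x_c, x_a x_b x_c^{−1}, x_a², x_b², x_c² lie in (0,1), and define the Neumann–Zagier potential W₀(x_a,x_b,x_c) = g(x_a x_b x_c) + g(x_a^{−1} x_b x_c) + g(x_a x_b^{−1} x_c) + g(x_a x_b x_c^{−1}) − g(x_a²) − g(x_b²) − g(x_c²). Then W₀ is differentiable in x_a with x_a · ∂W₀/∂x_a = log[ (1 − x_a x_b x_c)(1 − x_a x_b x_c^{−1})(1 − x_a x_b^{−1} x_c) / ( (1 − x_a^{−1}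 x_b x_c)(1 − x_a²)² ) ] (in particular all logarithmic terms in x_a, x_b, x_c cancel), and consequently y_a := − exp( x_a · ∂W₀/∂x_a ) satisfies the classical A-polynomial equation A_a(y_a; x_a, x_b, x_c) = 0. -/
open Real

/-- The dilogarithm `Li₂(x) = ∑_{n≥1} xⁿ/n²`. -/
noncomputable def Li2 (x : ℝ) : ℝ := ∑' n : ℕ, x ^ (n + 1) / ((n : ℝ) + 1) ^ 2

/-- The function `g(x) = -(log x)²/4 - Li₂(x)`. -/
noncomputable def gNZ (x : ℝ) : ℝ := -(Real.log x) ^ 2 / 4 - Li2 x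

/-- The (log-free part of the) Neumann–Zagier potential of the theta graph:
`W₀ = g(x_ax_bx_c) + g(x_a⁻¹x_bx_c) + g(x_ax_b⁻¹x_c) + g(x_ax_bx_c⁻¹)
  - g(x_a²) - g(x_b²) - g(x_c²)`. -/
noncomputable def thetaW0 (xa xb xc : ℝ) : ℝ :=
  gNZ (xa * xb * xc) + gNZ (xa⁻¹ * xb * xc) + gNZ (xa * xb⁻¹ * xc) + gNZ (xa * xb * xc⁻¹)
    - gNZ (xa ^ 2) - gNZ (xb ^ 2) - gNZ (xc ^ 2)

/-- The classical A-polynomial of the theta graph in the `a`-direction. -/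
noncomputable def thetaApolyA (y xa xb xc : ℝ) : ℝ :=
  xa * (xa * xb - xc) * (xa * xc - xb) * (1 - xa * xb * xc) +
    xb * xc * (1 - xa ^ 2) ^ 2 * (xa - xb * xc) * y

/-- On `(0, 1)` the dilogarithm has derivative `-log (1 - x) / x`. -/
theorem hasDerivAt_Li2 {x : ℝ} (hx : x ∈ Set.Ioo (0 : ℝ) 1) :
    HasDerivAt Li2 (-Real.log (1 - x) / x) x := by
  obtain ⟨r, hxr, hr1⟩ := exists_between hx.2
  have hr0 : 0 < r := hx.1.trans hxr
  have hterm (n : ℕ) (y : ℝ) :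
      HasDerivAt (fun z : ℝ => z ^ (n + 1) / ((n : ℝ) + 1) ^ 2) (y ^ n / ((n : ℝ) + 1)) y := by
    have hn : (n : ℝ) + 1 ≠ 0 := by positivity
    refine ((hasDerivAt_pow (n + 1) y).div_const (((n : ℝ) + 1) ^ 2)).congr_deriv ?_
    push_cast
    field_simp
  have hbound (n : ℕ) (y : ℝ) (hy : y ∈ Set.Ioo (-r) r) : ‖y ^ n / ((n : ℝ) + 1)‖ ≤ r ^ n := by
    rw [norm_div, norm_pow, Real.norm_eq_abs, Real.norm_of_nonneg (by positivity)]
    calc |y| ^ n / ((n : ℝ) + 1) ≤ |y| ^ n :=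
          div_le_self (by positivity) (by linarith [n.cast_nonneg (α := ℝ)])
      _ ≤ r ^ n := by
          gcongr
          exact (abs_lt.2 hy).le
  have hderiv := hasDerivAt_tsum_of_isPreconnected (y₀ := (0 : ℝ)) (y := x)
    (summable_geometric_of_lt_one hr0.le hr1) isOpen_Ioo isPreconnected_Ioo
    (fun n y _ => hterm n y) hbound ⟨neg_lt_zero.2 hr0, hr0⟩ (by simp)
    ⟨by linarith [hx.1], hxr⟩
  have hlog := Real.hasSum_pow_div_log_of_abs_lt_one (abs_lt.2 ⟨by linarith [hx.1], hx.2⟩)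
  have hsum : ∑' n : ℕ, x ^ n / ((n : ℝ) + 1) = -Real.log (1 - x) / x := by
    rw [← (hlog.div_const x).tsum_eq]
    refine tsum_congr fun n => ?_
    have hx0 := hx.1.ne'
    rw [pow_succ]
    field_simp
  rwa [hsum] at hderiv

/-- On `(0, 1)` the function `g` has derivative `(log (1 - x) - log x / 2) / x`. -/
theorem hasDerivAt_gNZ {x : ℝ} (hx : x ∈ Set.Ioo (0 : ℝ) 1) :
    HasDerivAt gNZ ((Real.log (1 - x) - Real.log x / 2) / x) x := by
  have h := ((((Real.hasDerivAt_log hx.1.ne').pow 2).neg).div_const 4).sub (hasDerivAt_Li2 hx)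
  refine h.congr_deriv ?_
  have hx0 := hx.1.ne'
  field_simp
  push_cast
  ring

/-- Logarithmic chain rule for `g`: if `f` has logarithmic derivative `k / t` at `t`, then
`g ∘ f` has derivative `k (log (1 - f t) - log (f t) / 2) / t` there. -/
theorem HasDerivAt.gNZ_comp {f : ℝ → ℝ} {k t : ℝ} (hf : HasDerivAt f (k * f t / t) t)
    (hft : f t ∈ Set.Ioo (0 : ℝ) 1) :
    HasDerivAt (fun s => gNZ (f s))
      (k * (Real.log (1 - f t) - Real.log (f t) / 2) / t) t := by
  refine ((hasDerivAt_gNZ hft).comp t hf).congr_deriv ?_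
  have h0 := hft.1.ne'
  field_simp

/-- `W₀` is differentiable in `x_a` with
`x_a ∂W₀/∂x_a = log[(1 - x_ax_bx_c)(1 - x_ax_bx_c⁻¹)(1 - x_ax_b⁻¹x_c) /
  ((1 - x_a⁻¹x_bx_c)(1 - x_a²)²)]` (all logarithmic terms cancel), and consequently
`y_a := -exp(x_a ∂W₀/∂x_a)` satisfies `A_a(y_a; x_a,x_b,x_c) = 0`. -/
theorem thetaW0_deriv (xa xb xc : ℝ) (hxa : 0 < xa) (hxb : 0 < xb) (hxc : 0 < xc)
    (h1 : xa * xb * xc ∈ Set.Ioo (0 : ℝ) 1)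
    (h2 : xa⁻¹ * xb * xc ∈ Set.Ioo (0 : ℝ) 1)
    (h3 : xa * xb⁻¹ * xc ∈ Set.Ioo (0 : ℝ) 1)
    (h4 : xa * xb * xc⁻¹ ∈ Set.Ioo (0 : ℝ) 1)
    (h5 : xa ^ 2 ∈ Set.Ioo (0 : ℝ) 1) (h6 : xb ^ 2 ∈ Set.Ioo (0 : ℝ) 1)
    (h7 : xc ^ 2 ∈ Set.Ioo (0 : ℝ) 1) :
    DifferentiableAt ℝ (fun t => thetaW0 t xb xc) xa ∧
    xa * deriv (fun t => thetaW0 t xb xc) xa =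
      Real.log ((1 - xa * xb * xc) * (1 - xa * xb * xc⁻¹) * (1 - xa * xb⁻¹ * xc) /
        ((1 - xa⁻¹ * xb * xc) * (1 - xa ^ 2) ^ 2)) ∧
    thetaApolyA (-Real.exp (xa * deriv (fun t => thetaW0 t xb xc) xa)) xa xb xc = 0 := by
  have ha := hxa.ne'
  have hb := hxb.ne'
  have hc := hxc.ne'
  have d1 : HasDerivAt (fun t => t * xb * xc) (1 * (xa * xb * xc) / xa) xa :=
    (((hasDerivAt_id xa).mul_const xb).mul_const xc).congr_deriv (by field_simp)
  have d2 : HasDerivAt (fun t => t⁻¹ * xb * xc) (-1 * (xa⁻¹ * xb * xc) / xa) xa :=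
    (((hasDerivAt_inv ha).mul_const xb).mul_const xc).congr_deriv (by field_simp)
  have d3 : HasDerivAt (fun t => t * xb⁻¹ * xc) (1 * (xa * xb⁻¹ * xc) / xa) xa :=
    (((hasDerivAt_id xa).mul_const xb⁻¹).mul_const xc).congr_deriv (by field_simp)
  have d4 : HasDerivAt (fun t => t * xb * xc⁻¹) (1 * (xa * xb * xc⁻¹) / xa) xa :=
    (((hasDerivAt_id xa).mul_const xb).mul_const xc⁻¹).congr_deriv (by field_simp)
  have d5 : HasDerivAt (fun t => t ^ 2) (2 * xa ^ 2 / xa) xa :=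
    (hasDerivAt_pow 2 xa).congr_deriv (by push_cast; field_simp)
  have hW : HasDerivAt (fun t => thetaW0 t xb xc) _ xa :=
    ((((((d1.gNZ_comp h1).add (d2.gNZ_comp h2)).add (d3.gNZ_comp h3)).add
      (d4.gNZ_comp h4)).sub (d5.gNZ_comp h5)).sub_const (gNZ (xb ^ 2))).sub_const (gNZ (xc ^ 2))
  have p1 : 0 < 1 - xa * xb * xc := sub_pos.2 h1.2
  have p2 : 0 < 1 - xa⁻¹ * xb * xc := sub_pos.2 h2.2
  have p3 : 0 < 1 - xa * xb⁻¹ * xc := sub_pos.2 h3.2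
  have p4 : 0 < 1 - xa * xb * xc⁻¹ := sub_pos.2 h4.2
  have p5 : 0 < 1 - xa ^ 2 := sub_pos.2 h5.2
  have hlog : xa * deriv (fun t => thetaW0 t xb xc) xa =
      Real.log ((1 - xa * xb * xc) * (1 - xa * xb * xc⁻¹) * (1 - xa * xb⁻¹ * xc) /
        ((1 - xa⁻¹ * xb * xc) * (1 - xa ^ 2) ^ 2)) := by
    rw [hW.deriv, Real.log_div (by positivity) (by positivity),
      Real.log_mul (by positivity) p3.ne', Real.log_mul p1.ne' p4.ne',
      Real.log_mul p2.ne' (by positivity), Real.log_pow (n := 2) (x := 1 - xa ^ 2)]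
    have l1 : Real.log (xa * xb * xc) = Real.log xa + Real.log xb + Real.log xc := by
      rw [Real.log_mul (by positivity) hc, Real.log_mul ha hb]
    have l2 : Real.log (xa⁻¹ * xb * xc) = -Real.log xa + Real.log xb + Real.log xc := by
      rw [Real.log_mul (by positivity) hc, Real.log_mul (by positivity) hb, Real.log_inv]
    have l3 : Real.log (xa * xb⁻¹ * xc) = Real.log xa - Real.log xb + Real.log xc := by
      rw [Real.log_mul (by positivity) hc, Real.log_mul ha (by positivity), Real.log_inv]
      ring
    have l4 : Real.log (xa * xb * xc⁻¹) = Real.log xa + Real.log xb - Real.log xc := by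
      rw [Real.log_mul (by positivity) (by positivity), Real.log_mul ha hb, Real.log_inv]
      ring
    rw [l1, l2, l3, l4, Real.log_pow, ← add_div, ← add_div, ← add_div, ← sub_div,
      mul_div_cancel₀ _ ha]
    push_cast
    ring
  refine ⟨hW.differentiableAt, hlog, ?_⟩
  rw [hlog, Real.exp_log (by positivity), thetaApolyA]
  have hbc : xa - xb * xc ≠ 0 := by
    have : xa - xb * xc = xa * (1 - xa⁻¹ * xb * xc) := by field_simp
    rw [this]
    positivity
  have hden : 1 - xa⁻¹ * xb * xc = (xa - xb * xc) / xa := by field_simp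
  rw [hden]
  field_simp
  ring
end

section
/- Let x₁, x₂, x₃, x₄, x₁₂, x₂₃ and z be positive reals such that all eight numbers z, z/(x₁x₂x₁₂), z/(x₃x₄x₁₂), z/(x₁x₄x₂₃), z/(x₂x₃x₂₃), x₁x₂x₃x₄/z, x₁x₃x₁₂x₂₃/z, x₂x₄x₁₂x₂₃/z lie in (0,1). Then the tetrahedron Neumann–Zagier potential W̃₀ is differentiable in x₁ and x₁ · ∂W̃₀/∂x₁ = log[ x₃ (x₁x₂x₁₂ − z)(x₁x₄x₂₃ − z) / ( (z − x₁x₂x₃x₄)(z − x₁x₃x₁₂x₂₃) ) ]; in particular y₁ := exp( x₁ · ∂W̃₀/∂x₁ ) equals the rational expression x₃ (z − x₁x₂x₁₂)(z − x₁x₄x₂₃) / ( (z − x₁x₂x₃x₄)(z − x₁x₃x₁₂x₂₃) ). -/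
open Real

/-- The (log-free part of the) Neumann–Zagier potential of the tetrahedron graph:
`W̃₀ = g(z) - g(z/(x₁x₂x₁₂)) - g(z/(x₃x₄x₁₂)) - g(z/(x₁x₄x₂₃)) - g(z/(x₂x₃x₂₃))
  - g(x₁x₂x₃x₄/z) - g(x₁x₃x₁₂x₂₃/z) - g(x₂x₄x₁₂x₂₃/z)`. -/
noncomputable def tetW0 (x1 x2 x3 x4 x12 x23 z : ℝ) : ℝ :=
  gNZ z - gNZ (z / (x1 * x2 * x12)) - gNZ (z / (x3 * x4 * x12)) -
    gNZ (z / (x1 * x4 * x23)) - gNZ (z / (x2 * x3 * x23)) -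
    gNZ (x1 * x2 * x3 * x4 / z) - gNZ (x1 * x3 * x12 * x23 / z) -
    gNZ (x2 * x4 * x12 * x23 / z)

/-- The contribution to `t ∂/∂t` of a term whose argument is proportional to `t`. -/
theorem hasDerivAt_gNZ_of_hasDerivAt_div {u : ℝ → ℝ} {t : ℝ} (hu : HasDerivAt u (u t / t) t)
    (h : u t ∈ Set.Ioo (0 : ℝ) 1) :
    HasDerivAt (fun s => gNZ (u s)) ((Real.log (1 - u t) - Real.log (u t) / 2) / t) t := by
  refine ((hasDerivAt_gNZ h).comp t hu).congr_deriv ?_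
  have := h.1.ne'
  field_simp

/-- The contribution to `t ∂/∂t` of a term whose argument is inversely proportional to `t`. -/
theorem hasDerivAt_gNZ_of_hasDerivAt_neg_div {u : ℝ → ℝ} {t : ℝ}
    (hu : HasDerivAt u (-(u t / t)) t) (h : u t ∈ Set.Ioo (0 : ℝ) 1) :
    HasDerivAt (fun s => gNZ (u s)) (-((Real.log (1 - u t) - Real.log (u t) / 2) / t)) t := by
  refine ((hasDerivAt_gNZ h).comp t hu).congr_deriv ?_
  have := h.1.ne'
  field_simp

/-- `W̃₀` is differentiable in `x₁`, with
`x₁ ∂W̃₀/∂x₁ = log[x₃(x₁x₂x₁₂ - z)(x₁x₄x₂₃ - z) / ((z - x₁x₂x₃x₄)(z - x₁x₃x₁₂x₂₃))]`;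
in particular `y₁ := exp(x₁ ∂W̃₀/∂x₁)` equals
`x₃(z - x₁x₂x₁₂)(z - x₁x₄x₂₃) / ((z - x₁x₂x₃x₄)(z - x₁x₃x₁₂x₂₃))`. -/
theorem tetW0_deriv_x1 (x1 x2 x3 x4 x12 x23 z : ℝ)
    (hx1 : 0 < x1) (hx2 : 0 < x2) (hx3 : 0 < x3) (hx4 : 0 < x4)
    (hx12 : 0 < x12) (hx23 : 0 < x23)
    (h0 : z ∈ Set.Ioo (0 : ℝ) 1)
    (h1 : z / (x1 * x2 * x12) ∈ Set.Ioo (0 : ℝ) 1)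
    (h2 : z / (x3 * x4 * x12) ∈ Set.Ioo (0 : ℝ) 1)
    (h3 : z / (x1 * x4 * x23) ∈ Set.Ioo (0 : ℝ) 1)
    (h4 : z / (x2 * x3 * x23) ∈ Set.Ioo (0 : ℝ) 1)
    (h5 : x1 * x2 * x3 * x4 / z ∈ Set.Ioo (0 : ℝ) 1)
    (h6 : x1 * x3 * x12 * x23 / z ∈ Set.Ioo (0 : ℝ) 1)
    (h7 : x2 * x4 * x12 * x23 / z ∈ Set.Ioo (0 : ℝ) 1) :
    DifferentiableAt ℝ (fun t => tetW0 t x2 x3 x4 x12 x23 z) x1 ∧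
    x1 * deriv (fun t => tetW0 t x2 x3 x4 x12 x23 z) x1 =
      Real.log (x3 * (x1 * x2 * x12 - z) * (x1 * x4 * x23 - z) /
        ((z - x1 * x2 * x3 * x4) * (z - x1 * x3 * x12 * x23))) ∧
    Real.exp (x1 * deriv (fun t => tetW0 t x2 x3 x4 x12 x23 z) x1) =
      x3 * (z - x1 * x2 * x12) * (z - x1 * x4 * x23) /
        ((z - x1 * x2 * x3 * x4) * (z - x1 * x3 * x12 * x23)) := by
  have hz := h0.1
  have hderiv_a : HasDerivAt (fun t => z / (t * x2 * x12)) (-(z / (x1 * x2 * x12) / x1)) x1 := by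
    refine ((hasDerivAt_const x1 z).div (((hasDerivAt_id x1).mul_const x2).mul_const x12)
      (by simp only [id]; positivity)).congr_deriv ?_
    simp only [id]
    field_simp
    ring
  have hderiv_b : HasDerivAt (fun t => z / (t * x4 * x23)) (-(z / (x1 * x4 * x23) / x1)) x1 := by
    refine ((hasDerivAt_const x1 z).div (((hasDerivAt_id x1).mul_const x4).mul_const x23)
      (by simp only [id]; positivity)).congr_deriv ?_
    simp only [id]
    field_simp
    ring
  have hderiv_c : HasDerivAt (fun t => t * x2 * x3 * x4 / z) (x1 * x2 * x3 * x4 / z / x1) x1 := by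
    refine (((((hasDerivAt_id x1).mul_const x2).mul_const x3).mul_const x4).div_const
      z).congr_deriv ?_
    field_simp
  have hderiv_d : HasDerivAt (fun t => t * x3 * x12 * x23 / z)
      (x1 * x3 * x12 * x23 / z / x1) x1 := by
    refine (((((hasDerivAt_id x1).mul_const x3).mul_const x12).mul_const x23).div_const
      z).congr_deriv ?_
    field_simp
  have hW := (((((((hasDerivAt_const x1 (gNZ z)).sub
    (hasDerivAt_gNZ_of_hasDerivAt_neg_div hderiv_a h1)).sub
    (hasDerivAt_const x1 (gNZ (z / (x3 * x4 * x12))))).sub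
    (hasDerivAt_gNZ_of_hasDerivAt_neg_div hderiv_b h3)).sub
    (hasDerivAt_const x1 (gNZ (z / (x2 * x3 * x23))))).sub
    (hasDerivAt_gNZ_of_hasDerivAt_div hderiv_c h5)).sub
    (hasDerivAt_gNZ_of_hasDerivAt_div hderiv_d h6)).sub
    (hasDerivAt_const x1 (gNZ (x2 * x4 * x12 * x23 / z)))
  have ha : 0 < x1 * x2 * x12 - z := sub_pos.mpr ((div_lt_one (by positivity)).mp h1.2)
  have hb : 0 < x1 * x4 * x23 - z := sub_pos.mpr ((div_lt_one (by positivity)).mp h3.2)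
  have hc : 0 < z - x1 * x2 * x3 * x4 := sub_pos.mpr ((div_lt_one hz).mp h5.2)
  have hd : 0 < z - x1 * x3 * x12 * x23 := sub_pos.mpr ((div_lt_one hz).mp h6.2)
  have hlog : x1 * deriv (fun t => tetW0 t x2 x3 x4 x12 x23 z) x1 =
      Real.log (x3 * (x1 * x2 * x12 - z) * (x1 * x4 * x23 - z) /
        ((z - x1 * x2 * x3 * x4) * (z - x1 * x3 * x12 * x23))) := by
    have hW' : deriv (fun t => tetW0 t x2 x3 x4 x12 x23 z) x1 = _ := hW.deriv
    have ea : 1 - z / (x1 * x2 * x12) = (x1 * x2 * x12 - z) / (x1 * x2 * x12) := by field_simp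
    have eb : 1 - z / (x1 * x4 * x23) = (x1 * x4 * x23 - z) / (x1 * x4 * x23) := by field_simp
    have ec : 1 - x1 * x2 * x3 * x4 / z = (z - x1 * x2 * x3 * x4) / z := by field_simp
    have ed : 1 - x1 * x3 * x12 * x23 / z = (z - x1 * x3 * x12 * x23) / z := by field_simp
    rw [hW', ea, eb, ec, ed]
    simp (disch := positivity) only [Real.log_div, Real.log_mul]
    field_simp
    ring
  refine ⟨hW.differentiableAt, hlog, ?_⟩
  rw [hlog, Real.exp_log (by positivity)]
  ring
end
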